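/- Let Ω ⊆ ℝ × ℝ³ be open, let ω₁, ω₂, ω₃ : Ω → ℝ and R : Ω → ℝ be C², let B = (B₁,B₂,B₃) : ℝ³ → ℝ³ be C¹, let F_{a0}, F_{ai} : ℝ → ℝ (a,i = 1,2,3) and T₀, T₁, T₂, T₃ : ℝ → ℝ be functions, and let λ ∈ ℝ³. Assume that for all (t,x) ∈ Ω: (i) ∇_x ω_i · ∇_x ω_j = 0 for i ≠ j; (ii) Σ_{i=1}^3 F_{ia}(ω_i) ‖∇_x ω_i‖² = T_a(t) for a = 1,2,3; (iii) (2∇_x R + B(x))·∇_x ω_a + ∂_t ω_a + Δ_x ω_a = 0 for a = 1,2,3; (iv) Σ_{i=1}^3 F_{i0}(ω_i) ‖∇_x ω_i‖² + ∂_t R + Δ_x R + B(x)·∇_x R + ‖∇_x R‖² + T₀(t) + div B(x) = 0. Let φ₀ : ℝ → ℝ satisfy φ₀'(t) = (T₀(t) − Σ_i T_i(t)λ_i)φ₀(t) and let φ_a : ℝ → ℝ satisfy φ_a''(s) = (F_{a0}(s) + Σ_i F_{ai}(s)λ_i)φ_a(s). Then u(t,x) := e^{R(t,x)}·φ₀(t)·φ₁(ω₁(t,x))·φ₂(ω₂(t,x))·φ₃(ω₃(t,x))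 satisfies ∂_t u + Δ_x u + Σ_{a=1}^3 ∂_{x_a}(B_a(x) u) = 0 at every point of Ω. -/

import Mathlib

/-- Spatial partial derivative `∂f/∂x_a` of a function on `ℝ × ℝ³`. -/
noncomputable def pdx (a : Fin 3) (f : ℝ × (Fin 3 → ℝ) → ℝ)
    (p : ℝ × (Fin 3 → ℝ)) : ℝ :=
  deriv (fun s => f (p.1, Function.update p.2 a s)) (p.2 a)

/-- Time partial derivative `∂f/∂t` of a function on `ℝ × ℝ³`. -/
noncomputable def pdt (f : ℝ × (Fin 3 → ℝ) → ℝ) (p : ℝ × (Fin 3 → ℝ)) : ℝ :=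
  deriv (fun s => f (s, p.2)) p.1

/-- Partial derivative `∂g/∂x_a` of a function on `ℝ³`. -/
noncomputable def pds (a : Fin 3) (g : (Fin 3 → ℝ) → ℝ) (x : Fin 3 → ℝ) : ℝ :=
  deriv (fun s => g (Function.update x a s)) (x a)

theorem line_eq (a : Fin 3) (p : ℝ × (Fin 3 → ℝ)) : (p.1, Function.update p.2 a (p.2 a)) = p := by
  simp

theorem line_hasDerivAt (a : Fin 3) (p : ℝ × (Fin 3 → ℝ)) (s : ℝ) :
    HasDerivAt (fun s => (p.1, Function.update p.2 a s)) ((0 : ℝ), (Pi.single a 1 : Fin 3 → ℝ)) s :=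
  (hasDerivAt_const s p.1).prodMk (hasDerivAt_update p.2 a s)

theorem line_mem {Ω : Set (ℝ × (Fin 3 → ℝ))} (hΩ : IsOpen Ω) (a : Fin 3)
    (p : ℝ × (Fin 3 → ℝ)) (hp : p ∈ Ω) :
    ∀ᶠ s in nhds (p.2 a), (p.1, Function.update p.2 a s) ∈ Ω := by
  have hc := (line_hasDerivAt a p (p.2 a)).continuousAt
  apply hc.eventually_mem
  rw [line_eq]
  exact hΩ.mem_nhds hp

theorem pdx_fderiv (a : Fin 3) (f : ℝ × (Fin 3 → ℝ) → ℝ) (p : ℝ × (Fin 3 → ℝ))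
    (hf : DifferentiableAt ℝ f p) :
    HasDerivAt (fun s => f (p.1, Function.update p.2 a s))
      (fderiv ℝ f p ((0 : ℝ), (Pi.single a 1 : Fin 3 → ℝ))) (p.2 a) := by
  have h : HasFDerivAt f (fderiv ℝ f p) (p.1, Function.update p.2 a (p.2 a)) := by
    rw [line_eq]; exact hf.hasFDerivAt
  exact h.comp_hasDerivAt (p.2 a) (line_hasDerivAt a p (p.2 a))

theorem pdx_has (a : Fin 3) (f : ℝ × (Fin 3 → ℝ) → ℝ) (p : ℝ × (Fin 3 → ℝ))
    (hf : DifferentiableAt ℝ f p) :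
    HasDerivAt (fun s => f (p.1, Function.update p.2 a s)) (pdx a f p) (p.2 a) :=
  (pdx_fderiv a f p hf).differentiableAt.hasDerivAt

theorem pdt_has (f : ℝ × (Fin 3 → ℝ) → ℝ) (p : ℝ × (Fin 3 → ℝ))
    (hf : DifferentiableAt ℝ f p) :
    HasDerivAt (fun s => f (s, p.2)) (pdt f p) p.1 := by
  have h : HasFDerivAt f (fderiv ℝ f p) (p.1, p.2) := hf.hasFDerivAt
  exact (h.comp_hasDerivAt p.1 ((hasDerivAt_id p.1).prodMk
    (hasDerivAt_const p.1 p.2))).differentiableAt.hasDerivAt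

theorem c2_diff {Ω : Set (ℝ × (Fin 3 → ℝ))} (hΩ : IsOpen Ω) {f : ℝ × (Fin 3 → ℝ) → ℝ}
    (hf : ContDiffOn ℝ 2 f Ω) {p : ℝ × (Fin 3 → ℝ)} (hp : p ∈ Ω) : DifferentiableAt ℝ f p :=
  (hf.contDiffAt (hΩ.mem_nhds hp)).differentiableAt (by norm_num)

theorem pdx_diff {Ω : Set (ℝ × (Fin 3 → ℝ))} (hΩ : IsOpen Ω) {f : ℝ × (Fin 3 → ℝ) → ℝ}
    (hf : ContDiffOn ℝ 2 f Ω) {p : ℝ × (Fin 3 → ℝ)} (hp : p ∈ Ω) (a : Fin 3) :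
    DifferentiableAt ℝ (pdx a f) p := by
  have h1 : ContDiffAt ℝ 1 (fderiv ℝ f) p :=
    (hf.contDiffAt (hΩ.mem_nhds hp)).fderiv_right (by norm_num)
  have h2 : DifferentiableAt ℝ
      (fun q => fderiv ℝ f q ((0 : ℝ), (Pi.single a 1 : Fin 3 → ℝ))) p :=
    (h1.differentiableAt (by norm_num)).clm_apply (differentiableAt_const _)
  apply h2.congr_of_eventuallyEq
  filter_upwards [hΩ.mem_nhds hp] with q hq
  exact (pdx_fderiv a f q (c2_diff hΩ hf hq)).deriv

theorem d1_formula {r w0 w1 w2 f g0 g1 g2 : ℝ → ℝ} {r' w0' w1' w2' f' s : ℝ}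
    (hr : HasDerivAt r r' s) (h0 : HasDerivAt w0 w0' s) (h1 : HasDerivAt w1 w1' s)
    (h2 : HasDerivAt w2 w2' s) (hf : HasDerivAt f f' s)
    (k0 : Differentiable ℝ g0) (k1 : Differentiable ℝ g1) (k2 : Differentiable ℝ g2) :
    HasDerivAt (fun s => Real.exp (r s) * (f s * (g0 (w0 s) * g1 (w1 s) * g2 (w2 s))))
      (Real.exp (r s) * ((r' * f s + f') * (g0 (w0 s) * g1 (w1 s) * g2 (w2 s))
        + f s * (deriv g0 (w0 s) * w0' * g1 (w1 s) * g2 (w2 s)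
          + g0 (w0 s) * (deriv g1 (w1 s) * w1') * g2 (w2 s)
          + g0 (w0 s) * g1 (w1 s) * (deriv g2 (w2 s) * w2')))) s := by
  have c0 := (k0 (w0 s)).hasDerivAt.comp s h0
  have c1 := (k1 (w1 s)).hasDerivAt.comp s h1
  have c2 := (k2 (w2 s)).hasDerivAt.comp s h2
  refine (hr.exp.mul (hf.mul ((c0.mul c1).mul c2))).congr_deriv ?_
  simp only [Function.comp, Pi.mul_apply]
  ring

/-- if `ω₁, ω₂, ω₃, R` solve the R-separation system
(2.4a), (2.4b), (2.4c1), (2.4d1) and `φ₀, φ₁, φ₂, φ₃` solve the separation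
equations (2.l), then the R-separable Ansatz
`u = e^R φ₀(t) φ₁(ω₁) φ₂(ω₂) φ₃(ω₃)` solves the Fokker–Planck equation
`∂ₜu + Δu + Σₐ ∂ₐ(Bₐ u) = 0` on `Ω`. -/
theorem stmt_2 (Ω : Set (ℝ × (Fin 3 → ℝ))) (hΩ : IsOpen Ω)
    (ω : Fin 3 → ℝ × (Fin 3 → ℝ) → ℝ) (hω : ∀ i, ContDiffOn ℝ 2 (ω i) Ω)
    (R : ℝ × (Fin 3 → ℝ) → ℝ) (hR : ContDiffOn ℝ 2 R Ω)
    (B : (Fin 3 → ℝ) → (Fin 3 → ℝ)) (hB : ContDiff ℝ 1 B)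
    (F0 : Fin 3 → ℝ → ℝ) (F : Fin 3 → Fin 3 → ℝ → ℝ)
    (T0 : ℝ → ℝ) (T : Fin 3 → ℝ → ℝ) (lam : Fin 3 → ℝ)
    -- (i) equation (2.4a): orthogonality of the gradients
    (h1 : ∀ p ∈ Ω, ∀ i j : Fin 3, i ≠ j →
      (∑ a : Fin 3, pdx a (ω i) p * pdx a (ω j) p) = 0)
    -- (ii) equation (2.4b): Stäckel conditions
    (h2 : ∀ p ∈ Ω, ∀ a : Fin 3,
      (∑ i : Fin 3, F i a (ω i p) * ∑ j : Fin 3, (pdx j (ω i) p) ^ 2) = T a p.1)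
    -- (iii) equation (2.4c1)
    (h3 : ∀ p ∈ Ω, ∀ a : Fin 3,
      (∑ j : Fin 3, (2 * pdx j R p + B p.2 j) * pdx j (ω a) p) + pdt (ω a) p
        + (∑ j : Fin 3, pdx j (pdx j (ω a)) p) = 0)
    -- (iv) equation (2.4d1)
    (h4 : ∀ p ∈ Ω,
      (∑ i : Fin 3, F0 i (ω i p) * ∑ j : Fin 3, (pdx j (ω i) p) ^ 2)
        + pdt R p + (∑ j : Fin 3, pdx j (pdx j R) p)
        + (∑ j : Fin 3, B p.2 j * pdx j R p)
        + (∑ j : Fin 3, (pdx j R p) ^ 2)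
        + T0 p.1 + (∑ a : Fin 3, pds a (fun y => B y a) p.2) = 0)
    -- separation equations (2.l)
    (φ₀ : ℝ → ℝ) (hφ₀ : Differentiable ℝ φ₀)
    (hφ₀' : ∀ t : ℝ, deriv φ₀ t = (T0 t - ∑ i : Fin 3, T i t * lam i) * φ₀ t)
    (φ : Fin 3 → ℝ → ℝ) (hφ : ∀ a, Differentiable ℝ (φ a))
    (hφ' : ∀ a, Differentiable ℝ (deriv (φ a)))
    (hφ'' : ∀ (a : Fin 3) (s : ℝ),
      deriv (deriv (φ a)) s = (F0 a s + ∑ i : Fin 3, F a i s * lam i) * φ a s) :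
    ∀ p ∈ Ω,
      pdt (fun q => Real.exp (R q) * (φ₀ q.1 * ∏ a : Fin 3, φ a (ω a q))) p
      + (∑ a : Fin 3, pdx a (pdx a
          (fun q => Real.exp (R q) * (φ₀ q.1 * ∏ b : Fin 3, φ b (ω b q)))) p)
      + (∑ a : Fin 3, pdx a
          (fun q => B q.2 a * (Real.exp (R q) * (φ₀ q.1 * ∏ b : Fin 3, φ b (ω b q)))) p)
      = 0 := by
  intro p hp
  simp only [Fin.prod_univ_three]
  -- spatial first derivative
  have hx1 : ∀ q ∈ Ω, ∀ a : Fin 3, HasDerivAt (fun s => (fun q : ℝ × (Fin 3 → ℝ) =>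
      Real.exp (R q) * (φ₀ q.1 * (φ 0 (ω 0 q) * φ 1 (ω 1 q) * φ 2 (ω 2 q))))
        (q.1, Function.update q.2 a s))
      (Real.exp (R q) * (φ₀ q.1 * (pdx a R q * (φ 0 (ω 0 q) * φ 1 (ω 1 q) * φ 2 (ω 2 q))))
       + (Real.exp (R q) * (φ₀ q.1 * (deriv (φ 0) (ω 0 q) * φ 1 (ω 1 q) * φ 2 (ω 2 q)))
            * pdx a (ω 0) q
        + Real.exp (R q) * (φ₀ q.1 * (φ 0 (ω 0 q) * deriv (φ 1) (ω 1 q) * φ 2 (ω 2 q)))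
            * pdx a (ω 1) q
        + Real.exp (R q) * (φ₀ q.1 * (φ 0 (ω 0 q) * φ 1 (ω 1 q) * deriv (φ 2) (ω 2 q)))
            * pdx a (ω 2) q)) (q.2 a) := by
    intro q hq a
    have := d1_formula (pdx_has a R q (c2_diff hΩ hR hq))
      (pdx_has a (ω 0) q (c2_diff hΩ (hω 0) hq)) (pdx_has a (ω 1) q (c2_diff hΩ (hω 1) hq))
      (pdx_has a (ω 2) q (c2_diff hΩ (hω 2) hq)) (hasDerivAt_const (q.2 a) (φ₀ q.1))
      (hφ 0) (hφ 1) (hφ 2)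
    refine this.congr_deriv ?_
    simp only [line_eq]
    ring
  have ht : pdt (fun q : ℝ × (Fin 3 → ℝ) =>
      Real.exp (R q) * (φ₀ q.1 * (φ 0 (ω 0 q) * φ 1 (ω 1 q) * φ 2 (ω 2 q)))) p = _ :=
    (d1_formula (pdt_has R p (c2_diff hΩ hR hp))
      (pdt_has (ω 0) p (c2_diff hΩ (hω 0) hp)) (pdt_has (ω 1) p (c2_diff hΩ (hω 1) hp))
      (pdt_has (ω 2) p (c2_diff hΩ (hω 2) hp)) (hφ₀ p.1).hasDerivAt
      (hφ 0) (hφ 1) (hφ 2)).deriv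
  have hb : ∀ a : Fin 3, pdx a (fun q : ℝ × (Fin 3 → ℝ) => B q.2 a *
      (Real.exp (R q) * (φ₀ q.1 * (φ 0 (ω 0 q) * φ 1 (ω 1 q) * φ 2 (ω 2 q))))) p =
      pds a (fun y => B y a) p.2 * (Real.exp (R p) * (φ₀ p.1 * (φ 0 (ω 0 p) * φ 1 (ω 1 p) * φ 2 (ω 2 p))))
      + B p.2 a * (Real.exp (R p) * φ₀ p.1 * (pdx a R p * (φ 0 (ω 0 p) * φ 1 (ω 1 p) * φ 2 (ω 2 p))
          + deriv (φ 0) (ω 0 p) * pdx a (ω 0) p * φ 1 (ω 1 p) * φ 2 (ω 2 p)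
          + deriv (φ 1) (ω 1 p) * pdx a (ω 1) p * φ 0 (ω 0 p) * φ 2 (ω 2 p)
          + deriv (φ 2) (ω 2 p) * pdx a (ω 2) p * φ 0 (ω 0 p) * φ 1 (ω 1 p))) := by
    intro a
    have hBa : HasDerivAt (fun s => B (Function.update p.2 a s) a)
        (pds a (fun y => B y a) p.2) (p.2 a) := by
      have hd : Differentiable ℝ (fun y => B y a) :=
        differentiable_pi.1 (hB.differentiable (by norm_num)) a
      exact ((hd _).comp (p.2 a)
        (hasDerivAt_update p.2 a (p.2 a)).differentiableAt).hasDerivAt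
    refine (hBa.mul (hx1 p hp a)).deriv.trans ?_
    simp only [line_eq, Function.update_eq_self]
    ring
  have hxx : ∀ a : Fin 3, pdx a (pdx a (fun q : ℝ × (Fin 3 → ℝ) =>
      Real.exp (R q) * (φ₀ q.1 * (φ 0 (ω 0 q) * φ 1 (ω 1 q) * φ 2 (ω 2 q))))) p =
      Real.exp (R p) * φ₀ p.1 * ((pdx a (pdx a R) p + pdx a R p ^ 2) * (φ 0 (ω 0 p) * φ 1 (ω 1 p) * φ 2 (ω 2 p))
        + 2 * pdx a R p * (deriv (φ 0) (ω 0 p) * pdx a (ω 0) p * φ 1 (ω 1 p) * φ 2 (ω 2 p)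
          + deriv (φ 1) (ω 1 p) * pdx a (ω 1) p * φ 0 (ω 0 p) * φ 2 (ω 2 p)
          + deriv (φ 2) (ω 2 p) * pdx a (ω 2) p * φ 0 (ω 0 p) * φ 1 (ω 1 p))
        + ((deriv (deriv (φ 0)) (ω 0 p) * pdx a (ω 0) p ^ 2 + deriv (φ 0) (ω 0 p) * pdx a (pdx a (ω 0)) p)
            * φ 1 (ω 1 p) * φ 2 (ω 2 p)
          + (deriv (deriv (φ 1)) (ω 1 p) * pdx a (ω 1) p ^ 2 + deriv (φ 1) (ω 1 p) * pdx a (pdx a (ω 1)) p)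
            * φ 0 (ω 0 p) * φ 2 (ω 2 p)
          + (deriv (deriv (φ 2)) (ω 2 p) * pdx a (ω 2) p ^ 2 + deriv (φ 2) (ω 2 p) * pdx a (pdx a (ω 2)) p)
            * φ 0 (ω 0 p) * φ 1 (ω 1 p))
        + 2 * (deriv (φ 0) (ω 0 p) * deriv (φ 1) (ω 1 p) * φ 2 (ω 2 p) * (pdx a (ω 0) p * pdx a (ω 1) p)
          + deriv (φ 0) (ω 0 p) * deriv (φ 2) (ω 2 p) * φ 1 (ω 1 p) * (pdx a (ω 0) p * pdx a (ω 2) p)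
          + deriv (φ 1) (ω 1 p) * deriv (φ 2) (ω 2 p) * φ 0 (ω 0 p) * (pdx a (ω 1) p * pdx a (ω 2) p))) := by
    intro a
    have e := (line_mem hΩ a p hp).mono (fun s hs => (hx1 _ hs a).deriv)
    have r1 := pdx_has a R p (c2_diff hΩ hR hp)
    have w0 := pdx_has a (ω 0) p (c2_diff hΩ (hω 0) hp)
    have w1 := pdx_has a (ω 1) p (c2_diff hΩ (hω 1) hp)
    have w2 := pdx_has a (ω 2) p (c2_diff hΩ (hω 2) hp)
    have r2 := pdx_has a _ p (pdx_diff hΩ hR hp a)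
    have v0 := pdx_has a _ p (pdx_diff hΩ (hω 0) hp a)
    have v1 := pdx_has a _ p (pdx_diff hΩ (hω 1) hp a)
    have v2 := pdx_has a _ p (pdx_diff hΩ (hω 2) hp a)
    have c := hasDerivAt_const (p.2 a) (φ₀ p.1)
    have A := d1_formula r1 w0 w1 w2 c (hφ 0) (hφ 1) (hφ 2)
    have A0 := d1_formula r1 w0 w1 w2 c (hφ' 0) (hφ 1) (hφ 2)
    have A1 := d1_formula r1 w0 w1 w2 c (hφ 0) (hφ' 1) (hφ 2)
    have A2 := d1_formula r1 w0 w1 w2 c (hφ 0) (hφ 1) (hφ' 2)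
    have key := (A.mul r2).add (((A0.mul v0).add (A1.mul v1)).add (A2.mul v2))
    refine (HasDerivAt.deriv (key.congr_of_eventuallyEq ?_)).trans ?_
    rotate_left
    · simp only [line_eq]
      ring
    filter_upwards [e] with s hs
    refine hs.trans ?_
    simp only [Pi.mul_apply, Pi.add_apply]
    ring
  rw [ht]
  simp only [hb, hxx, line_eq, hφ'', hφ₀', Prod.mk.eta, Function.update_eq_self]
  have e01 := h1 p hp 0 1 (by decide)
  have e02 := h1 p hp 0 2 (by decide)
  have e12 := h1 p hp 1 2 (by decide)
  have s0 := h2 p hp 0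
  have s1 := h2 p hp 1
  have s2 := h2 p hp 2
  have c0 := h3 p hp 0
  have c1 := h3 p hp 1
  have c2 := h3 p hp 2
  have d := h4 p hp
  simp only [Fin.sum_univ_three] at *
  generalize Real.exp (R p) = E at *
  linear_combination (E * φ₀ p.1 * φ 0 (ω 0 p) * φ 1 (ω 1 p) * φ 2 (ω 2 p)) *
      (d + lam 0 * s0 + lam 1 * s1 + lam 2 * s2)
    + E * φ₀ p.1 * (deriv (φ 0) (ω 0 p) * φ 1 (ω 1 p) * φ 2 (ω 2 p) * c0
      + φ 0 (ω 0 p) * deriv (φ 1) (ω 1 p) * φ 2 (ω 2 p) * c1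
      + φ 0 (ω 0 p) * φ 1 (ω 1 p) * deriv (φ 2) (ω 2 p) * c2)
    + 2 * E * φ₀ p.1 * (deriv (φ 0) (ω 0 p) * deriv (φ 1) (ω 1 p) * φ 2 (ω 2 p) * e01
      + deriv (φ 0) (ω 0 p) * φ 1 (ω 1 p) * deriv (φ 2) (ω 2 p) * e02
      + φ 0 (ω 0 p) * deriv (φ 1) (ω 1 p) * deriv (φ 2) (ω 2 p) * e12)
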